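/- If NP ⊆ i.o.SIZE[n^k], then P^{NP[n]} ⊆ i.o.SIZE[n^{k+2}]. Moreover, the size-n^{k+2} circuits for a language L ∈ P^{NP[n]} can be taken to exist on the same (infinitely many) input lengths on which the assumed circuits for a suitable auxiliary NP language exist. -/

import Mathlib

open FirstOrder FirstOrder.Language

namespace CLB

/-! ### Binary length of a natural number (viewing numbers as binary strings). -/
def len (x : ℕ) : ℕ := Nat.size x

/-! ### Boolean circuits.
A circuit is a straight-line program: a list of gates, each gate a natural number
encoding (via pairing) its type (constant / input / not / and / or) and the indices
of its argument wires (earlier gates).  The size of a circuit is its number of gates. -/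

def gateEval (x : ℕ → Bool) (prev : List Bool) (g : ℕ) : Bool :=
  let t := g.unpair.1 % 5
  let a := g.unpair.2
  if t = 0 then a % 2 == 1
  else if t = 1 then x (a % (prev.length + 1))
  else if t = 2 then !(prev.getD a false)
  else if t = 3 then (prev.getD a.unpair.1 false) && (prev.getD a.unpair.2 false)
  else (prev.getD a.unpair.1 false) || (prev.getD a.unpair.2 false)

def circEvalList (C : List ℕ) (x : ℕ → Bool) : List Bool :=
  C.foldl (fun prev g => prev ++ [gateEval x prev g]) []

/-- The output of a circuit (the value of its last gate). -/
def circEval (C : List ℕ) (x : ℕ → Bool) : Bool := (circEvalList C x).getLastD false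

/-- Parsing a self-delimiting binary representation of a natural number. -/
def parseNum : List Bool → ℕ → ℕ × List Bool
  | [], acc => (acc, [])
  | [_], acc => (acc, [])
  | b :: c :: rest, acc => if b then parseNum rest (2 * acc + (cond c 1 0)) else (acc, rest)

def decodeLN : ℕ → List Bool → List ℕ
  | 0, _ => []
  | _ + 1, [] => []
  | f + 1, l => (parseNum l 0).1 :: decodeLN f (parseNum l 0).2

/-- Decoding a natural number (binary string) as a circuit. -/
def cDecode (x : ℕ) : List ℕ := decodeLN x.bits.length x.bits

/-- The number of gates of the circuit encoded by `x`. -/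
def csize (x : ℕ) : ℕ := (cDecode x).length

/-- Evaluation of an encoded circuit on the bits of an input string: `C(x)`. -/
def cEval (c x : ℕ) : ℕ := cond (circEval (cDecode c) x.testBit) 1 0

/-- `L` has a circuit with at most `s` gates deciding its length-`n` slice. -/
def HasCircAt (L : Set ℕ) (n s : ℕ) : Prop :=
  ∃ C : List ℕ, C.length ≤ s ∧ ∀ x : ℕ, len x = n → (circEval C x.testBit = true ↔ x ∈ L)

/-- `SIZE[s]`: circuits of size `s(n)` on every sufficiently large input length. -/
def SIZEae (s : ℕ → ℕ) : Set (Set ℕ) := {L | ∃ n₀, ∀ n ≥ n₀, HasCircAt L n (s n)}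

/-- `i.o.SIZE[s]`: circuits of size `s(n)` on infinitely many input lengths. -/
def ioSIZE (s : ℕ → ℕ) : Set (Set ℕ) := {L | ∀ n₀, ∃ n ≥ n₀, HasCircAt L n (s n)}

/-- `SIZE[poly]`. -/
def SIZEpoly : Set (Set ℕ) := {L | ∃ c, L ∈ SIZEae (fun n => n ^ c + c)}

/-! ### Polynomial-time functions.
Following Cobham's machine-independent characterization of the polynomial-time
functions (the characterization on which Cook's theory `PV` is based), `PTF` is the
smallest class of functions `ℕ → ℕ` (binary strings, paired via `Nat.pair`) containing
a stock of basic polynomial-time functions and closed under composition, pairing and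
limited recursion on notation. -/

/-- Limited recursion on notation (the recursive call is on the string with its last
bit removed, and the result is truncated by the bounding function `b`). -/
def limRonF (g h b : ℕ → ℕ) (x : ℕ) : ℕ → ℕ
  | 0 => g x
  | y + 1 =>
      min (h (Nat.pair x (Nat.pair (y + 1) (limRonF g h b x ((y + 1) / 2)))))
        (b (Nat.pair x (y + 1)))
  termination_by y => y
  decreasing_by exact Nat.div_lt_self (Nat.succ_pos y) one_lt_two

/-- The class of polynomial-time computable functions (Cobham-style algebra). -/
inductive PTF : (ℕ → ℕ) → Prop
  | id' : PTF (fun z => z)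
  | const (c : ℕ) : PTF (fun _ => c)
  | up1 : PTF (fun z => z.unpair.1)
  | up2 : PTF (fun z => z.unpair.2)
  | lenB : PTF (fun z => len z)
  | add : PTF (fun z => z.unpair.1 + z.unpair.2)
  | sub : PTF (fun z => z.unpair.1 - z.unpair.2)
  | mul : PTF (fun z => z.unpair.1 * z.unpair.2)
  | div : PTF (fun z => z.unpair.1 / z.unpair.2)
  | mod : PTF (fun z => z.unpair.1 % z.unpair.2)
  | smash : PTF (fun z => 2 ^ (len z.unpair.1 * len z.unpair.2))
  | unaryPow (c : ℕ) : PTF (fun z => 2 ^ (len z ^ c))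
  | powc (c : ℕ) : PTF (fun z => z ^ c)
  | ite0 : PTF (fun z => if z.unpair.1 = 0 then z.unpair.2.unpair.1 else z.unpair.2.unpair.2)
  | csizeB : PTF (fun z => csize z)
  | cEvalB : PTF (fun z => cEval z.unpair.1 z.unpair.2)
  | evalnB : PTF (fun z =>
      (Nat.Partrec.Code.evaln (len z.unpair.1)
        (Denumerable.ofNat Nat.Partrec.Code z.unpair.2.unpair.1) z.unpair.2.unpair.2).getD 0)
  | comp {f g} : PTF f → PTF g → PTF (fun z => f (g z))
  | pairF {f g} : PTF f → PTF g → PTF (fun z => Nat.pair (f z) (g z))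
  | limRon {g h b} : PTF g → PTF h → PTF b →
      PTF (fun z => limRonF g h b z.unpair.1 z.unpair.2)

theorem PTF.comp2 {F : ℕ → ℕ → ℕ} (hF : PTF (fun z => F z.unpair.1 z.unpair.2))
    {g h : ℕ → ℕ} (hg : PTF g) (hh : PTF h) : PTF (fun z => F (g z) (h z)) := by
  have := hF.comp (hg.pairF hh)
  simpa using this

/-! ### Complexity classes (over the standard model). -/

/-- `P`: polynomial-time decidable languages. -/
def Pclass : Set (Set ℕ) := {L | ∃ f, PTF f ∧ ∀ x, x ∈ L ↔ f x = 1}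

/-- `NP`: languages with polynomial-time verifiable, polynomially short witnesses. -/
def NPclass : Set (Set ℕ) :=
  {L | ∃ (c : ℕ) (V : ℕ → ℕ), PTF V ∧
    ∀ x, x ∈ L ↔ ∃ y, len y ≤ len x ^ c + c ∧ V (Nat.pair x y) = 1}

/-- Polynomial-time many-one reducibility. -/
def PolyReducible (A B : Set ℕ) : Prop := ∃ f, PTF f ∧ ∀ x, x ∈ A ↔ f x ∈ B

/-- `NP`-completeness (w.r.t. polynomial-time many-one reductions). -/
def NPComplete (O : Set ℕ) : Prop := O ∈ NPclass ∧ ∀ L ∈ NPclass, PolyReducible L O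

/-- Encoding a list of oracle answers as a number. -/
def encodeBools (l : List Bool) : ℕ := l.foldl (fun n b => 2 * n + (cond b 1 0)) 1

open Classical in
/-- The list of answers of oracle `O` to the first `i` adaptively generated
queries, where the next query is computed by `q` from the input and the
previous answers. -/
noncomputable def answers (O : Set ℕ) (q : ℕ → ℕ) (x : ℕ) : ℕ → List Bool
  | 0 => []
  | i + 1 =>
      answers O q x i ++
        [if q (Nat.pair x (encodeBools (answers O q x i))) ∈ O then true else false]

/-- `P^{O[ℓ]}`: languages decided in deterministic polynomial time with at most
`ℓ(n)` adaptive queries to the oracle `O` (queries generated by the polynomial-time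
function `q`, final decision by the polynomial-time function `d`). -/
def PNPQ (O : Set ℕ) (ℓ : ℕ → ℕ) : Set (Set ℕ) :=
  {L | ∃ q d, PTF q ∧ PTF d ∧
    ∀ x, x ∈ L ↔ d (Nat.pair x (encodeBools (answers O q x (ℓ (len x))))) = 1}

/-- `P^NP`: polynomial time with polynomially many adaptive queries to an
`NP`-complete oracle. -/
def PNPclass : Set (Set ℕ) :=
  {L | ∃ O, NPComplete O ∧ ∃ c, L ∈ PNPQ O (fun n => n ^ c + c)}

/-- `P^{NP[n]}`: at most `n` adaptive queries to an `NP`-complete oracle. -/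
def PNPnClass : Set (Set ℕ) := {L | ∃ O, NPComplete O ∧ L ∈ PNPQ O (fun n => n)}

/-- `P^{NP[c·log n]}`: at most `c·(log n + 1)` adaptive queries to an `NP`-complete oracle. -/
def PNPlogClass (c : ℕ) : Set (Set ℕ) :=
  {L | ∃ O, NPComplete O ∧ L ∈ PNPQ O (fun n => c * (Nat.log 2 n + 1))}

/-- The levels `Σ^p_k` of the polynomial hierarchy. -/
def SigmaP : ℕ → Set (Set ℕ)
  | 0 => Pclass
  | k + 1 =>
      {L | ∃ (c : ℕ) (L' : Set ℕ), L' ∈ SigmaP k ∧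
        ∀ x, x ∈ L ↔ ∃ y, len y ≤ len x ^ c + c ∧ Nat.pair x y ∉ L'}

/-- The polynomial hierarchy `PH`. -/
def PHclass : Set (Set ℕ) := {L | ∃ k, L ∈ SigmaP k}

/-- Output of a randomized oracle machine: decision function `d` applied to input `x`,
random string `r` and the answers to `m` adaptive oracle queries. -/
noncomputable def zppOut (O : Set ℕ) (q d : ℕ → ℕ) (m : ℕ) (x r : ℕ) : ℕ :=
  d (Nat.pair (Nat.pair x r) (encodeBools (answers O q (Nat.pair x r) m)))

/-- `ZPP^{NP[O(log n)]}`: zero-error probabilistic polynomial time with `O(log n)`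
adaptive queries to an `NP`-complete oracle.  The machine outputs `1` (accept),
`0` (reject) or anything else (abort `?`); it is never wrong and aborts with
probability at most `1/2` over the uniformly random string `r`. -/
noncomputable def ZPPNPlogClass : Set (Set ℕ) :=
  {L | ∃ O, NPComplete O ∧ ∃ (c : ℕ) (q d : ℕ → ℕ), PTF q ∧ PTF d ∧
    ∀ x : ℕ,
      (∀ r < 2 ^ (len x ^ c + c),
        (zppOut O q d (c * (Nat.log 2 (len x) + 1)) x r = 1 → x ∈ L) ∧
        (zppOut O q d (c * (Nat.log 2 (len x) + 1)) x r = 0 → x ∉ L)) ∧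
      2 * {r | r < 2 ^ (len x ^ c + c) ∧
            zppOut O q d (c * (Nat.log 2 (len x) + 1)) x r ≠ 1 ∧
            zppOut O q d (c * (Nat.log 2 (len x) + 1)) x r ≠ 0}.ncard
        ≤ 2 ^ (len x ^ c + c)}

/-! ### Kannan's hard language. -/

/-- `T` (a truth table for input length `n`) is hard for circuits of size `n^k`. -/
def TTHard (n k : ℕ) (T : ℕ) : Prop :=
  T < 2 ^ 2 ^ n ∧
    ¬ ∃ C : List ℕ, C.length ≤ n ^ k ∧ ∀ x : ℕ, len x = n → circEval C x.testBit = T.testBit x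

/-- The lexicographically first truth table on length-`n` inputs that is hard for
circuits of size `n^k` (or `0` if none exists). -/
noncomputable def leastHardTT (n k : ℕ) : ℕ := sInf {T | TTHard n k T}

/-- The language whose length-`n` slice is the lexicographically first truth table
of a function on length-`n` inputs not computable by circuits of size `n^k`. -/
noncomputable def kannanLang (k : ℕ) : Set ℕ :=
  {x | (leastHardTT (len x) k).testBit x = true}

end CLB

namespace CLB

/-! ### The language `L(PV)`.
`L(PV)` has a function symbol for each polynomial-time algorithm (of each arity,
multi-ary functions being handled via the pairing function), together with the
order relation `≤`.  Equality is built into first-order logic. -/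

/-- Decoding a number as a tuple of arguments. -/
def argAt : ℕ → ℕ → ℕ
  | z, 0 => z.unpair.1
  | z, i + 1 => argAt z.unpair.2 i

def decodeVec (n : ℕ) (z : ℕ) : Fin n → ℕ := fun i => argAt z i.val

/-- `f : (Fin n → ℕ) → ℕ` is a polynomial-time `n`-ary function. -/
def PolyVec (n : ℕ) (f : (Fin n → ℕ) → ℕ) : Prop := PTF (fun z => f (decodeVec n z))

inductive LPVRel : ℕ → Type | le : LPVRel 2

/-- The first-order language of `PV`: a function symbol for every polynomial-time
algorithm, and the relation symbol `≤`. -/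
def LPV : FirstOrder.Language :=
  ⟨fun n => {f : (Fin n → ℕ) → ℕ // PolyVec n f}, LPVRel⟩

/-- The standard model `ℕ`: every function symbol is interpreted by the
polynomial-time function it names. -/
instance : LPV.Structure ℕ where
  funMap f v := f.1 v
  RelMap r v := match r with | LPVRel.le => v 0 ≤ v 1

abbrev BF (n : ℕ) := LPV.BoundedFormula Empty n
abbrev Tm (n : ℕ) := LPV.Term (Empty ⊕ Fin n)

/-! ### Construction of some particular `PV` function symbols. -/

def mkF0 (c : ℕ) : LPV.Functions 0 := ⟨fun _ => c, PTF.const c⟩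

def mkF1 (f : ℕ → ℕ) (h : PTF (fun z => f z.unpair.1)) : LPV.Functions 1 :=
  ⟨fun v => f (v 0), h⟩

def mkF2 (f : ℕ → ℕ → ℕ) (h : PTF (fun z => f z.unpair.1 z.unpair.2.unpair.1)) :
    LPV.Functions 2 :=
  ⟨fun v => f (v 0) (v 1), h⟩

def mkF3 (f : ℕ → ℕ → ℕ → ℕ)
    (h : PTF (fun z => f z.unpair.1 z.unpair.2.unpair.1 z.unpair.2.unpair.2.unpair.1)) :
    LPV.Functions 3 :=
  ⟨fun v => f (v 0) (v 1) (v 2), h⟩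

/-- The constant `0`. -/
def zeroF : LPV.Functions 0 := mkF0 0
/-- The constant `1`. -/
def oneF : LPV.Functions 0 := mkF0 1
/-- The length function `x ↦ |x|`. -/
def lenSym : LPV.Functions 1 := mkF1 len (PTF.lenB.comp PTF.up1)
/-- Circuit size `C ↦ |C|` (number of gates). -/
def csizeSym : LPV.Functions 1 := mkF1 csize (PTF.csizeB.comp PTF.up1)
/-- Circuit evaluation `(C, x) ↦ C(x)`. -/
def cEvalSym : LPV.Functions 2 :=
  mkF2 cEval (PTF.comp2 PTF.cEvalB PTF.up1 (PTF.up1.comp PTF.up2))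
/-- Successor `x ↦ x + 1`. -/
def succSym : LPV.Functions 1 :=
  mkF1 (fun x => x + 1) (PTF.comp2 PTF.add PTF.up1 (PTF.const 1))
/-- `x ↦ x + c`. -/
def addConstSym (c : ℕ) : LPV.Functions 1 :=
  mkF1 (fun x => x + c) (PTF.comp2 PTF.add PTF.up1 (PTF.const c))
/-- `x ↦ 2x + 1`. -/
def dblS1Sym : LPV.Functions 1 :=
  mkF1 (fun x => 2 * x + 1)
    (PTF.comp2 PTF.add (PTF.comp2 PTF.mul (PTF.const 2) PTF.up1) (PTF.const 1))
/-- `x ↦ |x|^k`. -/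
def powLenSym (k : ℕ) : LPV.Functions 1 :=
  mkF1 (fun x => len x ^ k) ((PTF.powc k).comp (PTF.lenB.comp PTF.up1))
/-- The all-ones string of the length of `x`:  `x ↦ 2^{|x|} - 1` (i.e. `1^{(|x|)}`). -/
def onesSym : LPV.Functions 1 :=
  mkF1 (fun x => 2 ^ len x - 1)
    (by
      have h1 : PTF (fun z => 2 ^ (len z.unpair.1 ^ 1)) := (PTF.unaryPow 1).comp PTF.up1
      have h : PTF (fun z => 2 ^ len z.unpair.1) := by simpa using h1
      exact PTF.comp2 PTF.sub h (PTF.const 1))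
/-- The unary clock `x ↦ 1^{(|x|^c)} = 2^{|x|^c} - 1`. -/
def clockSym (c : ℕ) : LPV.Functions 1 :=
  mkF1 (fun x => 2 ^ (len x ^ c) - 1)
    (PTF.comp2 PTF.sub ((PTF.unaryPow c).comp PTF.up1) (PTF.const 1))
/-- Pairing. -/
def pairSym : LPV.Functions 2 := mkF2 Nat.pair (PTF.up1.pairF (PTF.up1.comp PTF.up2))
/-- First projection. -/
def fstSym : LPV.Functions 1 := mkF1 (fun x => x.unpair.1) (PTF.up1.comp PTF.up1)
/-- Second projection. -/
def sndSym : LPV.Functions 1 := mkF1 (fun x => x.unpair.2) (PTF.up2.comp PTF.up1)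
/-- The clocked universal machine: `(s, e, x) ↦` the output of the algorithm with
code `e` on input `x` run for `|s|` steps (and `0` if it has not halted). -/
def timedSym : LPV.Functions 3 :=
  mkF3 (fun s e x =>
      (Nat.Partrec.Code.evaln (len s) (Denumerable.ofNat Nat.Partrec.Code e) x).getD 0)
    (by
      have := PTF.evalnB.comp
        (PTF.up1.pairF ((PTF.up1.comp PTF.up2).pairF
          (PTF.up1.comp (PTF.up2.comp PTF.up2))))
      simpa using this)

/-! ### Formula-building helpers. -/

def xv {n : ℕ} (i : Fin n) : Tm n := Term.var (Sum.inr i)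
def ap1 {n : ℕ} (f : LPV.Functions 1) (t : Tm n) : Tm n := Term.func f ![t]
def ap2 {n : ℕ} (f : LPV.Functions 2) (t s : Tm n) : Tm n := Term.func f ![t, s]
def ap3 {n : ℕ} (f : LPV.Functions 3) (t s u : Tm n) : Tm n := Term.func f ![t, s, u]
def cst {n : ℕ} (f : LPV.Functions 0) : Tm n := Term.func f ![]
def oneT {n : ℕ} : Tm n := cst oneF
def zeroT {n : ℕ} : Tm n := cst zeroF
def leF {n : ℕ} (t s : Tm n) : BF n := BoundedFormula.rel LPVRel.le ![t, s]
def andF {n : ℕ} (φ ψ : BF n) : BF n := (φ.imp ψ.not).not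
def orF {n : ℕ} (φ ψ : BF n) : BF n := φ.not.imp ψ

/-- `θ(t)`: substitution of a term for the topmost (de Bruijn) variable, expressed
via a quantifier: `∀ y (y = t → θ(y))`. -/
def substTop {n : ℕ} (t : Tm n) (θ : BF (n + 1)) : BF n :=
  ((Term.bdEqual (xv (Fin.last n)) (t.liftAt 1 n)).imp θ).all

/-- The bounded existential quantifier `∃ y ≤ t, θ`. -/
def bdEx {n : ℕ} (t : Tm n) (θ : BF (n + 1)) : BF n :=
  (andF (leF (xv (Fin.last n)) (t.liftAt 1 n)) θ).ex

/-- The bounded universal quantifier `∀ y ≤ t, θ`. -/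
def bdAll {n : ℕ} (t : Tm n) (θ : BF (n + 1)) : BF n :=
  ((leF (xv (Fin.last n)) (t.liftAt 1 n)).imp θ).all

/-- `Σ^b_1(PV)`-formulas: a block of bounded existential quantifiers in front of a
quantifier-free formula. -/
inductive IsSigmaB1 : ∀ {n : ℕ}, BF n → Prop
  | of_qf {n : ℕ} {φ : BF n} : φ.IsQF → IsSigmaB1 φ
  | bdex {n : ℕ} (t : Tm n) {φ : BF (n + 1)} : IsSigmaB1 φ → IsSigmaB1 (bdEx t φ)

/-- `Π^b_1(PV)`-formulas. -/
inductive IsPiB1 : ∀ {n : ℕ}, BF n → Prop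
  | of_qf {n : ℕ} {φ : BF n} : φ.IsQF → IsPiB1 φ
  | bdall {n : ℕ} (t : Tm n) {φ : BF (n + 1)} : IsPiB1 φ → IsPiB1 (bdAll t φ)

/-- `Σ^b_2(PV)`-formulas: bounded existential quantifiers in front of a
quantifier-free formula or the negation of a `Σ^b_1`-formula (i.e. a `Π^b_1`-formula). -/
inductive IsSigmaB2 : ∀ {n : ℕ}, BF n → Prop
  | of_pi {n : ℕ} {φ : BF n} : IsPiB1 φ → IsSigmaB2 φ
  | bdex {n : ℕ} (t : Tm n) {φ : BF (n + 1)} : IsSigmaB2 φ → IsSigmaB2 (bdEx t φ)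

/-- Bounded formulas (all quantifiers bounded). -/
inductive IsBdd : ∀ {n : ℕ}, BF n → Prop
  | of_qf {n : ℕ} {φ : BF n} : φ.IsQF → IsBdd φ
  | imp {n : ℕ} {φ ψ : BF n} : IsBdd φ → IsBdd ψ → IsBdd (φ.imp ψ)
  | bdex {n : ℕ} (t : Tm n) {φ : BF (n + 1)} : IsBdd φ → IsBdd (bdEx t φ)
  | bdall {n : ℕ} (t : Tm n) {φ : BF (n + 1)} : IsBdd φ → IsBdd (bdAll t φ)

/-! ### Theories and provability. -/

/-- Provability: by Gödel's completeness theorem we identify provability from a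
first-order theory with semantic consequence. -/
def Proves (T : LPV.Theory) (S : LPV.Sentence) : Prop := T ⊨ᵇ S

/-- `True₀`: the theory of all true universal `L(PV)`-sentences.  (Cook's theory
`PV` is a universal theory sound for the standard model, so `PV ⊆ True₀`; following
the paper, all results are stated for theories containing the corresponding
true sentences, which only strengthens unprovability results.) -/
def True0 : LPV.Theory :=
  {S | (∃ (n : ℕ) (θ : BF n), θ.IsQF ∧ S = θ.alls) ∧ ℕ ⊨ S}

/-- The theory `PV`, taken extensionally (as in the paper, everything works for the
theory of all true universal `L(PV)`-sentences, which contains `PV`). -/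
def PVT : LPV.Theory := True0

/-- `True₁`: the theory of all true `∀Σ^b_1(PV)`-sentences. -/
def True1 : LPV.Theory :=
  {S | (∃ (n : ℕ) (θ : BF n), IsSigmaB1 θ ∧ S = θ.alls) ∧ ℕ ⊨ S}

/-- The length-induction axiom `LIND` for `θ` (with the induction variable the
topmost variable, all other variables universally quantified parameters):
`θ(0) ∧ ∀ x (θ(x) → θ(x+1)) → ∀ x θ(|x|)`. -/
def LINDax {n : ℕ} (θ : BF (n + 1)) : LPV.Sentence :=
  ((andF (substTop zeroT θ)
      ((θ.imp (((Term.bdEqual (xv (⟨n + 1, by omega⟩ : Fin (n + 2)))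
          (ap1 succSym (xv (⟨n, by omega⟩ : Fin (n + 2))))).imp (θ.liftAt 1 n)).all)).all)).imp
    ((((Term.bdEqual (xv (⟨n + 1, by omega⟩ : Fin (n + 2)))
        (ap1 lenSym (xv (⟨n, by omega⟩ : Fin (n + 2))))).imp (θ.liftAt 1 n)).all).all)).alls

/-- The induction axiom `IND` for `θ`:  `θ(0) ∧ ∀ x (θ(x) → θ(x+1)) → ∀ x θ(x)`. -/
def INDax {n : ℕ} (θ : BF (n + 1)) : LPV.Sentence :=
  ((andF (substTop zeroT θ)
      ((θ.imp (((Term.bdEqual (xv (⟨n + 1, by omega⟩ : Fin (n + 2)))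
          (ap1 succSym (xv (⟨n, by omega⟩ : Fin (n + 2))))).imp (θ.liftAt 1 n)).all)).all)).imp
    θ.all).alls

/-- The `Σ^b_1(PV)`-LIND scheme. -/
def LIND1 : LPV.Theory := {S | ∃ (n : ℕ) (θ : BF (n + 1)), IsSigmaB1 θ ∧ S = LINDax θ}

/-- The `Σ^b_1(PV)`-IND scheme. -/
def IND1 : LPV.Theory := {S | ∃ (n : ℕ) (θ : BF (n + 1)), IsSigmaB1 θ ∧ S = INDax θ}

/-- The `Σ^b_2(PV)`-LIND scheme. -/
def LIND2 : LPV.Theory := {S | ∃ (n : ℕ) (θ : BF (n + 1)), IsSigmaB2 θ ∧ S = LINDax θ}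

/-- The surjective weak pigeonhole principle for the function symbol `f` (with a
parameter): `∀ p ∀ a ∃ v ≤ 2a+1 ∀ u ≤ a, f(p,u) ≠ v`. -/
def sWPHPax (f : LPV.Functions 2) : LPV.Sentence :=
  let inner : BF 4 :=
    (leF (xv (3 : Fin 4)) (xv (1 : Fin 4))).imp
      ((Term.bdEqual (ap2 f (xv (0 : Fin 4)) (xv (3 : Fin 4))) (xv (2 : Fin 4))).not)
  let block : BF 3 :=
    andF (leF (xv (2 : Fin 3)) (ap1 dblS1Sym (xv (1 : Fin 3)))) inner.all
  block.ex.all.all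

/-- `sWPHP(PV)`: the surjective weak pigeonhole principle for all `PV` function symbols. -/
def sWPHPthy : LPV.Theory := {S | ∃ f : LPV.Functions 2, S = sWPHPax f}

/-! ### The sentences `UB^k_io(φ)` and friends. -/

/-- The language defined by the `L(PV)`-formula `φ(x)` in the standard model. -/
def LangOf (φ : BF 1) : Set ℕ := {x | φ.Realize (fun e => e.elim) ![x]}

/-- The atomic formula `f(x) = 1` defining the language of the `PV` function symbol `f`. -/
def atomicF (f : LPV.Functions 1) : BF 1 :=
  Term.bdEqual (ap1 f (xv (0 : Fin 1))) oneT

/-- The sentence `UB^k_io(φ)`: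
`∀ 1^{(n)} ∃ 1^{(m)} (m ≥ n) ∃ C_m (|C_m| ≤ m^k) ∀ x (|x| = m), φ(x) ≡ (C_m(x) = 1)`,
formalizing that the boolean functions defined by `φ` are computed on infinitely many
input lengths `m` by circuits with at most `m^k` gates.  (Variables: `y` with `n = |y|`,
`z` with `m = |z|`, the circuit `C`, and the input `x`.) -/
def UBio (k : ℕ) (φ : BF 1) : LPV.Sentence :=
  let inner : BF 4 :=
    (Term.bdEqual (ap1 lenSym (xv (3 : Fin 4))) (ap1 lenSym (xv (1 : Fin 4)))).imp
      ((φ.liftAt 3 0).iff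
        (Term.bdEqual (ap2 cEvalSym (xv (2 : Fin 4)) (xv (3 : Fin 4))) oneT))
  let block : BF 3 :=
    andF (leF (ap1 lenSym (xv (0 : Fin 3))) (ap1 lenSym (xv (1 : Fin 3))))
      (andF (leF (ap1 csizeSym (xv (2 : Fin 3))) (ap1 (powLenSym k) (xv (1 : Fin 3))))
        inner.all)
  block.ex.ex.all

/-- The sentence expressing that the language of `φ` has circuits of size `m^c + c`
on every sufficiently large input length `m` (`φ ∈ SIZE[poly]`, witnessed by the
exponent `c`). -/
def UBae (c : ℕ) (φ : BF 1) : LPV.Sentence :=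
  let inner : BF 4 :=
    (Term.bdEqual (ap1 lenSym (xv (3 : Fin 4))) (ap1 lenSym (xv (1 : Fin 4)))).imp
      ((φ.liftAt 3 0).iff
        (Term.bdEqual (ap2 cEvalSym (xv (2 : Fin 4)) (xv (3 : Fin 4))) oneT))
  let block : BF 3 :=
    andF
      (leF (ap1 csizeSym (xv (2 : Fin 3)))
        (ap1 (addConstSym c) (ap1 (powLenSym c) (xv (1 : Fin 3)))))
      inner.all
  let quant : BF 2 :=
    (leF (ap1 lenSym (xv (0 : Fin 2))) (ap1 lenSym (xv (1 : Fin 2)))).imp block.ex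
  quant.all.ex

/-- The sentence expressing that the language of `φ` has circuits of size `m^c + c`
on every input length `m`. -/
def UBevery (c : ℕ) (φ : BF 1) : LPV.Sentence :=
  let inner : BF 3 :=
    (Term.bdEqual (ap1 lenSym (xv (2 : Fin 3))) (ap1 lenSym (xv (0 : Fin 3)))).imp
      ((φ.liftAt 2 0).iff
        (Term.bdEqual (ap2 cEvalSym (xv (1 : Fin 3)) (xv (2 : Fin 3))) oneT))
  let block : BF 2 :=
    andF
      (leF (ap1 csizeSym (xv (1 : Fin 2)))
        (ap1 (addConstSym c) (ap1 (powLenSym c) (xv (0 : Fin 2)))))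
      inner.all
  block.ex.all

/-- `LB^k_tt(h) = ¬ UB^k_io(h)`: the language of `h` is hard for circuits of size
`m^k` on every input length `m ≥ n`, for some fixed `n`. -/
def LBtt (k : ℕ) (h : LPV.Functions 1) : LPV.Sentence := (UBio k (atomicF h)).not

end CLB

namespace CLB

/-! ### Further sentences used in the statements. -/

/-- The sentence expressing (provable) paddability of the encoding of the language
defined by `φ`, via the padding function symbol `pd`:
`∀ x ∀ z (|x| ≤ |z| → |pd(x,z)| = |z| ∧ (φ(pd(x,z)) ↔ φ(x)))`. -/
def padSent (φ : BF 1) (pd : LPV.Functions 2) : LPV.Sentence :=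
  let t : Tm 2 := ap2 pd (xv (0 : Fin 2)) (xv (1 : Fin 2))
  let phiAt : Tm 2 → BF 2 := fun s =>
    ((Term.bdEqual (xv (2 : Fin 3)) (s.liftAt 1 2)).imp (φ.liftAt 2 0)).all
  let inner : BF 2 :=
    (leF (ap1 lenSym (xv (0 : Fin 2))) (ap1 lenSym (xv (1 : Fin 2)))).imp
      (andF (Term.bdEqual (ap1 lenSym t) (ap1 lenSym (xv (1 : Fin 2))))
        ((phiAt t).iff (phiAt (xv (0 : Fin 2)))))
  inner.alls

/-- The sentence `PNP(ψ) = ∀ x ∀ y (ψ(x,y) → ψ(x, f(x)))`: the polynomial-time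
algorithm `f` finds satisfying assignments for all satisfiable formulas (where
`ψ(x,y)` expresses that `y` satisfies the formula encoded by `x`). -/
def PNPsent (ψ : BF 2) (f : LPV.Functions 1) : LPV.Sentence :=
  (ψ.imp ((substTop (ap1 f (xv (0 : Fin 1))) ψ).liftAt 1 1)).all.all

/-- The satisfaction relation of the `NP`-complete satisfiability problem:
`y` encodes a satisfying assignment of the (circuit form of the) propositional
formula encoded by `x`. -/
def SatRel (x y : ℕ) : Prop := circEval (cDecode x) y.testBit = true

/-- The sentence expressing that `g` is hard on all input lengths against every
algorithm (code `e`) running in time `|x|^{k'-1}` that uses an advice string `w`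
with `|w| ≤ n^{k'}`:
`∀ e ∀ w ∀ 1^{(n)} (|w| ≤ n^{k'} → ∃ x (|x| = n ∧ e(w,x) ≠ g(x)))`. -/
def hardSent (g : LPV.Functions 1) (k' : ℕ) : LPV.Sentence :=
  let run : Tm 4 :=
    ap3 timedSym (ap1 (clockSym (k' - 1)) (xv (3 : Fin 4))) (xv (0 : Fin 4))
      (ap2 pairSym (xv (1 : Fin 4)) (xv (3 : Fin 4)))
  let inner : BF 4 :=
    andF (Term.bdEqual (ap1 lenSym (xv (3 : Fin 4))) (ap1 lenSym (xv (2 : Fin 4))))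
      ((Term.bdEqual run (ap1 g (xv (3 : Fin 4)))).not)
  let body : BF 3 :=
    (leF (ap1 lenSym (xv (1 : Fin 3))) (ap1 (powLenSym k') (xv (2 : Fin 3)))).imp inner.ex
  body.all.all.all

/-- The term `f_i(1^{(n)}, x_1, …, x_{i-1})` in the context with variables
`y = x₀` (the string `1^{(n)}`) and `x_1, …, x_r`. -/
def kptTerm (r : ℕ) (f : (i : Fin r) → LPV.Functions (i + 1)) (i : Fin r) : Tm (r + 1) :=
  Term.func (f i) (fun j => xv ⟨j.val, by have := j.isLt; have := i.isLt; omega⟩)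

/-- The `i`-th disjunct of the KPT disjunction: writing
`(1^{(n_i)}, C^i) := f_i(1^{(n)}, x_1, …, x_{i-1})`, it says
`n_i ≥ n ∧ |C^i| ≤ n_i^k ∧ (|x_i| = n_i → C^i(x_i) = g(x_i))`. -/
def kptDisjunct (k : ℕ) (g : LPV.Functions 1) (r : ℕ)
    (f : (i : Fin r) → LPV.Functions (i + 1)) (i : Fin r) : BF (r + 1) :=
  let t := kptTerm r f i
  let ni : Tm (r + 1) := ap1 lenSym (ap1 fstSym t)
  let Ci : Tm (r + 1) := ap1 sndSym t
  let xi : Tm (r + 1) := xv ⟨i.val + 1, by have := i.isLt; omega⟩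
  andF (leF (ap1 lenSym (xv (⟨0, by omega⟩ : Fin (r + 1)))) ni)
    (andF (leF (ap1 csizeSym Ci) (ap1 (powLenSym k) (ap1 fstSym t)))
      ((Term.bdEqual (ap1 lenSym xi) ni).imp
        (Term.bdEqual (ap2 cEvalSym Ci xi) (ap1 g xi))))

/-- The universal closure of the KPT disjunction obtained by applying the KPT
witnessing theorem to `UB^k_io(g)`. -/
def kptSent (k : ℕ) (g : LPV.Functions 1) (r : ℕ)
    (f : (i : Fin r) → LPV.Functions (i + 1)) : LPV.Sentence :=
  ((List.finRange r).foldr (fun i acc => orF (kptDisjunct k g r f i) acc)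
    BoundedFormula.falsum).alls

/-- The universal closure of `n_i ≤ n^{a_i}`, i.e.
`|fst (f_i(1^{(n)}, x_1, …, x_{i-1}))| ≤ |1^{(n)}|^{a_i} + a_i` (provable polynomial
bound on the output length parameter of the KPT function `f_i`). -/
def lenBoundSent (r : ℕ) (f : (i : Fin r) → LPV.Functions (i + 1)) (i : Fin r)
    (a : ℕ) : LPV.Sentence :=
  (leF (ap1 lenSym (ap1 fstSym (kptTerm r f i)))
    (ap1 (addConstSym a) (ap1 (powLenSym a) (xv (⟨0, by omega⟩ : Fin (r + 1)))))).alls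

/-- `⌊n^{1/c}⌋`. -/
def nthRoot (c n : ℕ) : ℕ := Nat.findGreatest (fun m => m ^ c ≤ n) n

/-- The padded succinct direct-connection language `L¹_succ` of the circuits
produced by the first KPT function `f₁`: its members are tuples
`⟨Bin(n), 1^{(n^{1/10k})}, u, v, w, 1^t⟩` (encoded by iterated pairing, with the
padding parameter `t` arbitrary and ignored) such that gate `u` of the circuit
`C¹ := snd (f₁(1^{(n)}))` is described by the pair `(v, w)`. -/
def LtildeFun (k : ℕ) (f1 : LPV.Functions 1) (z : ℕ) : ℕ :=
  let n := z.unpair.1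
  let pad := z.unpair.2.unpair.1
  let u := z.unpair.2.unpair.2.unpair.1
  let v := z.unpair.2.unpair.2.unpair.2.unpair.1
  let w := z.unpair.2.unpair.2.unpair.2.unpair.2.unpair.1
  let C := cDecode (f1.1 ![2 ^ n - 1]).unpair.2
  if pad = 2 ^ nthRoot (10 * k) n - 1 ∧ C.getD u 0 = Nat.pair v w then 1 else 0

/-- The sentence stating that `u₁` enumerates (all-ones) input parameters
`1^{(n)} = u₁(1^{(ℓ)})` with `n ≥ ℓ` and `|u₁(1^{(ℓ)})| ≤ ℓ^{c₁} + c₁`, and that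
`e₁(1^{(ℓ)})` is a counter-example of length `n₁ = |fst(f₁(u₁(1^{(ℓ)})))|` on which the
circuit `snd(f₁(u₁(1^{(ℓ)})))` produced by `f₁` fails to compute `g`. -/
def ceSent (g f1 u1 e1 : LPV.Functions 1) (c1 : ℕ) : LPV.Sentence :=
  let y : Tm 1 := xv (0 : Fin 1)
  let uy : Tm 1 := ap1 u1 y
  let ey : Tm 1 := ap1 e1 y
  let n1 : Tm 1 := ap1 lenSym (ap1 fstSym (ap1 f1 uy))
  let C1 : Tm 1 := ap1 sndSym (ap1 f1 uy)
  (andF (Term.bdEqual uy (ap1 onesSym uy))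
    (andF (leF (ap1 lenSym y) (ap1 lenSym uy))
      (andF (leF (ap1 lenSym uy) (ap1 (addConstSym c1) (ap1 (powLenSym c1) y)))
        (andF (Term.bdEqual (ap1 lenSym ey) n1)
          ((Term.bdEqual (ap1 g ey) (ap2 cEvalSym C1 ey)).not))))).alls

end CLB

namespace CLB


/-! ### Polynomial length bounds for `PTF` functions. -/

theorem size_mul_le (a b : ℕ) : Nat.size (a * b) ≤ Nat.size a + Nat.size b := by
  rw [Nat.size_le, pow_add]
  exact Nat.mul_lt_mul'' (Nat.lt_size_self a) (Nat.lt_size_self b)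

theorem size_pair_le (a b : ℕ) : Nat.size (Nat.pair a b) ≤ 2 * (Nat.size a + Nat.size b) := by
  rw [Nat.size_le]
  have h1 := Nat.pair_lt_max_add_one_sq a b
  have h2 : max a b + 1 ≤ 2 ^ (Nat.size a + Nat.size b) := by
    have ha := Nat.lt_size_self a
    have hb := Nat.lt_size_self b
    have h3 : 2 ^ Nat.size a ≤ 2 ^ (Nat.size a + Nat.size b) :=
      Nat.pow_le_pow_right (by norm_num) (by omega)
    have h4 : 2 ^ Nat.size b ≤ 2 ^ (Nat.size a + Nat.size b) :=
      Nat.pow_le_pow_right (by norm_num) (by omega)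
    have : max a b < 2 ^ (Nat.size a + Nat.size b) := max_lt (by omega) (by omega)
    omega
  calc _ < (max a b + 1) ^ 2 := h1
    _ ≤ (2 ^ (Nat.size a + Nat.size b)) ^ 2 := Nat.pow_le_pow_left h2 2
    _ = _ := by rw [← pow_mul, mul_comm]

theorem size_pow_le (a c : ℕ) : Nat.size (a ^ c) ≤ Nat.size a * c + 1 := by
  rw [Nat.size_le]
  calc a ^ c ≤ (2 ^ Nat.size a) ^ c := Nat.pow_le_pow_left (Nat.lt_size_self a).le c
    _ = 2 ^ (Nat.size a * c) := by rw [pow_mul]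
    _ < _ := Nat.pow_lt_pow_right (by norm_num) (by omega)

theorem size_self_le (a : ℕ) : Nat.size a ≤ a := by
  rw [Nat.size_le]; exact Nat.lt_two_pow_self

open Nat.Partrec in
theorem size_encode_pair (a b : Code) :
    2 * (max (Nat.size (Code.encodeCode a)) (Nat.size (Code.encodeCode b)) + 1) ≤
      Nat.size (Code.encodeCode (Code.pair a b)) + 1 := by
  have key : ∀ u w : ℕ, u ≤ w → ∀ e, 4 * (w * w) + 4 ≤ e → 2 * (Nat.size u + 1) ≤ Nat.size e + 1 := by
    intro u w huw e he
    have h1 : Nat.size u ≤ Nat.size w := Nat.size_le_size huw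
    suffices 2 * Nat.size w + 1 ≤ Nat.size e by omega
    have : 2 * Nat.size w < Nat.size e := by
      rw [Nat.lt_size]
      rcases Nat.eq_zero_or_pos w with h | h
      · subst h; simp; omega
      · have h2 : 2 ^ (Nat.size w - 1) ≤ w := by
          rw [← Nat.lt_size]
          have := Nat.size_pos.2 h
          omega
        have h3 : Nat.size w - 1 + 1 = Nat.size w := by
          have := Nat.size_pos.2 h
          omega
        have h4 : 2 ^ Nat.size w ≤ 2 * w := by
          rw [← h3, pow_succ]; omega
        rw [mul_comm, pow_mul, sq]
        have h5 := Nat.mul_le_mul h4 h4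
        have h6 : 2 * w * (2 * w) = 4 * (w * w) := by ring
        omega
    omega
  have hp : max (Code.encodeCode a) (Code.encodeCode b) * max (Code.encodeCode a) (Code.encodeCode b) ≤
      Nat.pair (Code.encodeCode a) (Code.encodeCode b) := by
    have := Nat.max_sq_add_min_le_pair (Code.encodeCode a) (Code.encodeCode b)
    rw [sq] at this
    omega
  have he : 4 * (max (Code.encodeCode a) (Code.encodeCode b) * max (Code.encodeCode a) (Code.encodeCode b)) + 4
      ≤ Code.encodeCode (Code.pair a b) := by
    simp only [Code.encodeCode]
    omega
  have h1 := key _ _ (le_max_left _ _) _ he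
  have h2 := key _ _ (le_max_right _ _) _ he
  omega

open Nat.Partrec in
theorem evaln_bound : ∀ (k : ℕ) (c : Code) (n v : ℕ), v ∈ Code.evaln k c n →
    v + 1 ≤ (k + 2) ^ (Nat.size (Code.encodeCode c) + 1) := by
  intro k
  have base : ∀ (k v s : ℕ), v ≤ k + 1 → v + 1 ≤ (k + 2) ^ (s + 1) := by
    intro k v s h
    calc v + 1 ≤ (k + 2) ^ 1 := by rw [pow_one]; omega
      _ ≤ _ := Nat.pow_le_pow_right (by omega) (by omega)
  have mono : ∀ (k v a b : ℕ), v + 1 ≤ (k + 2) ^ (Nat.size a + 1) → a < b →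
      v + 1 ≤ (k + 2) ^ (Nat.size b + 1) := by
    intro k v a b h hab
    refine h.trans (Nat.pow_le_pow_right (by omega) ?_)
    have := Nat.size_le_size hab.le
    omega
  induction k with
  | zero => intro c n v h; simp [Code.evaln, Option.bind_eq_some_iff] at h
  | succ k ihk =>
    intro c
    induction c with
    | zero => intro n v h; simp [Code.evaln, Option.bind_eq_some_iff] at h; exact base _ _ _ (by omega)
    | succ => intro n v h; simp [Code.evaln, Option.bind_eq_some_iff] at h; exact base _ _ _ (by omega)
    | left =>
      intro n v h; simp [Code.evaln, Option.bind_eq_some_iff] at h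
      have := Nat.unpair_left_le n
      exact base _ _ _ (by omega)
    | right =>
      intro n v h; simp [Code.evaln, Option.bind_eq_some_iff] at h
      have := Nat.unpair_right_le n
      exact base _ _ _ (by omega)
    | pair cf cg ihf ihg =>
      intro n v h
      simp [Code.evaln, Option.bind_eq_some_iff, Seq.seq] at h
      obtain ⟨_, a, ha, b, hb, rfl⟩ := h
      have h1 := ihf n a ha
      have h2 := ihg n b hb
      set M := max (Nat.size (Code.encodeCode cf)) (Nat.size (Code.encodeCode cg)) with hM
      have h3 : a + 1 ≤ (k + 1 + 2) ^ (M + 1) :=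
        h1.trans (Nat.pow_le_pow_right (by omega) (by omega))
      have h4 : b + 1 ≤ (k + 1 + 2) ^ (M + 1) :=
        h2.trans (Nat.pow_le_pow_right (by omega) (by omega))
      have h5 := Nat.pair_lt_max_add_one_sq a b
      have h6 : max a b + 1 ≤ (k + 1 + 2) ^ (M + 1) := by omega
      calc Nat.pair a b + 1 ≤ (max a b + 1) ^ 2 := h5
        _ ≤ ((k + 1 + 2) ^ (M + 1)) ^ 2 := Nat.pow_le_pow_left h6 2
        _ = (k + 1 + 2) ^ (2 * (M + 1)) := by rw [← pow_mul, mul_comm]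
        _ ≤ _ := Nat.pow_le_pow_right (by omega) (size_encode_pair cf cg)
    | comp cf cg ihf ihg =>
      intro n v h
      simp [Code.evaln, Option.bind_eq_some_iff] at h
      obtain ⟨_, a, ha, hb⟩ := h
      exact mono _ _ _ _ (ihf _ _ hb) (Code.encode_lt_comp cf cg).1
    | prec cf cg ihf ihg =>
      intro n v h
      simp [Code.evaln, Option.bind_eq_some_iff] at h
      obtain ⟨_, h⟩ := h
      cases hn : n.unpair.2 with
      | zero =>
        rw [hn] at h
        exact mono _ _ _ _ (ihf _ _ h) (Code.encode_lt_prec cf cg).1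
      | succ y =>
        rw [hn] at h
        simp [Option.bind_eq_some_iff] at h
        obtain ⟨i, _, hb⟩ := h
        exact mono _ _ _ _ (ihg _ _ hb) (Code.encode_lt_prec cf cg).2
    | rfind' cf ihf =>
      intro n v h
      simp [Code.evaln, Option.bind_eq_some_iff] at h
      obtain ⟨hn, a, ha, hb⟩ := h
      split at hb
      · have := Nat.unpair_right_le n
        have hb' : n.unpair.2 = v := by simpa using hb
        exact base _ _ _ (by omega)
      · have := ihk _ _ _ hb
        exact this.trans (Nat.pow_le_pow_left (by omega) _)

theorem decodeLN_length (f : ℕ) : ∀ l, (decodeLN f l).length ≤ f := by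
  induction f with
  | zero => intro l; simp [decodeLN]
  | succ f ih =>
    intro l
    cases l with
    | nil => simp [decodeLN]
    | cons b l => simp only [decodeLN, List.length_cons]; exact Nat.succ_le_succ (ih _)

theorem csize_le (z : ℕ) : csize z ≤ Nat.size z := by
  unfold csize cDecode
  rw [Nat.size_eq_bits_len]
  exact decodeLN_length _ _

theorem cEval_le (c x : ℕ) : cEval c x ≤ 1 := by
  unfold cEval
  cases circEval (cDecode c) x.testBit <;> simp

/-- Polynomial boundedness, in a form closed under composition. -/
def PBd (f : ℕ → ℕ) : Prop := ∃ c, ∀ z, len (f z) + 2 ≤ (len z + 2) ^ c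

theorem PBd.of_poly {f : ℕ → ℕ} (a b : ℕ) (h : ∀ z, len (f z) ≤ a * (len z + 2) ^ b) : PBd f := by
  refine ⟨a + 2 + b, fun z => ?_⟩
  have h1 : a + 2 ≤ (len z + 2) ^ (a + 2) :=
    (Nat.lt_two_pow_self (n := a + 2)).le.trans (Nat.pow_le_pow_left (by omega) _)
  have h2 : 1 ≤ (len z + 2) ^ b := Nat.one_le_pow _ _ (by omega)
  rw [pow_add]
  have := h z
  nlinarith

theorem PBd.le {f g : ℕ → ℕ} (h : ∀ z, f z ≤ g z) (hg : PBd g) : PBd f := by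
  obtain ⟨c, hc⟩ := hg
  refine ⟨c, fun z => le_trans ?_ (hc z)⟩
  have : len (f z) ≤ len (g z) := Nat.size_le_size (h z)
  omega

theorem PBd.comp {f g : ℕ → ℕ} (hf : PBd f) (hg : PBd g) : PBd (fun z => f (g z)) := by
  obtain ⟨c, hc⟩ := hf
  obtain ⟨e, he⟩ := hg
  refine ⟨e * c, fun z => (hc _).trans ?_⟩
  rw [pow_mul]
  exact Nat.pow_le_pow_left (he z) c

theorem PBd.pairF {f g : ℕ → ℕ} (hf : PBd f) (hg : PBd g) :
    PBd (fun z => Nat.pair (f z) (g z)) := by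
  obtain ⟨c, hc⟩ := hf
  obtain ⟨e, he⟩ := hg
  apply PBd.of_poly 4 (c + e)
  intro z
  have h1 := size_pair_le (f z) (g z)
  have h2 : (len z + 2) ^ c ≤ (len z + 2) ^ (c + e) := Nat.pow_le_pow_right (by omega) (by omega)
  have h3 : (len z + 2) ^ e ≤ (len z + 2) ^ (c + e) := Nat.pow_le_pow_right (by omega) (by omega)
  have := hc z
  have := he z
  unfold len at *
  omega

theorem PBd.idb : PBd (fun z => z) := ⟨1, fun z => by simp⟩

theorem PBd.u1 : PBd (fun z => z.unpair.1) := PBd.le Nat.unpair_left_le PBd.idb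
theorem PBd.u2 : PBd (fun z => z.unpair.2) := PBd.le Nat.unpair_right_le PBd.idb

theorem PBd.mulP : PBd (fun z => z.unpair.1 * z.unpair.2) := by
  apply PBd.of_poly 2 1
  intro z
  have h := size_mul_le z.unpair.1 z.unpair.2
  have h1 := Nat.size_le_size (Nat.unpair_left_le z)
  have h2 := Nat.size_le_size (Nat.unpair_right_le z)
  unfold len
  rw [pow_one]
  omega

theorem PBd.addP : PBd (fun z => z.unpair.1 + z.unpair.2) := by
  apply PBd.of_poly 2 1
  intro z
  have h1 := Nat.unpair_left_le z
  have h2 := Nat.unpair_right_le z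
  have h : Nat.size (z.unpair.1 + z.unpair.2) ≤ Nat.size z + 1 := by
    rw [Nat.size_le, pow_succ]
    have := Nat.lt_size_self z
    omega
  unfold len
  rw [pow_one]
  omega

theorem PTF.pbd {f : ℕ → ℕ} (hf : PTF f) : PBd f := by
  induction hf with
  | id' => exact PBd.idb
  | const c =>
    apply PBd.of_poly (len c) 0
    intro z; simp
  | up1 => exact PBd.u1
  | up2 => exact PBd.u2
  | lenB => exact PBd.le size_self_le PBd.idb
  | add => exact PBd.addP
  | sub => exact PBd.le (fun z => Nat.sub_le _ _) PBd.u1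
  | mul => exact PBd.mulP
  | div => exact PBd.le (fun z => Nat.div_le_self _ _) PBd.u1
  | mod => exact PBd.le (fun z => Nat.mod_le _ _) PBd.u1
  | smash =>
    apply PBd.of_poly 1 2
    intro z
    have h1 := Nat.size_le_size (Nat.unpair_left_le z)
    have h2 := Nat.size_le_size (Nat.unpair_right_le z)
    unfold len
    rw [Nat.size_pow]
    nlinarith [Nat.mul_le_mul h1 h2]
  | unaryPow c =>
    apply PBd.of_poly 2 c
    intro z
    unfold len
    rw [Nat.size_pow]
    have h1 : Nat.size z ^ c ≤ (Nat.size z + 2) ^ c := Nat.pow_le_pow_left (by omega) c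
    have h2 : 1 ≤ (Nat.size z + 2) ^ c := Nat.one_le_pow _ _ (by omega)
    omega
  | powc c =>
    apply PBd.of_poly (c + 1) 1
    intro z
    have := size_pow_le z c
    unfold len
    nlinarith
  | ite0 =>
    refine PBd.le (fun z => ?_) PBd.idb
    have h := Nat.unpair_right_le z
    have h1 := Nat.unpair_left_le z.unpair.2
    have h2 := Nat.unpair_right_le z.unpair.2
    split <;> omega
  | csizeB => exact PBd.le (fun z => (csize_le z).trans (size_self_le z)) PBd.idb
  | cEvalB =>
    refine PBd.le (fun z => cEval_le _ _) (PBd.of_poly (len 1) 0 ?_)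
    intro z; simp
  | evalnB =>
    apply PBd.of_poly 1 2
    intro z
    have hs := Nat.size_le_size (Nat.unpair_left_le z)
    have he : Nat.size z.unpair.2.unpair.1 ≤ Nat.size z :=
      Nat.size_le_size ((Nat.unpair_left_le _).trans (Nat.unpair_right_le z))
    cases hv : Nat.Partrec.Code.evaln (len z.unpair.1)
        (Denumerable.ofNat Nat.Partrec.Code z.unpair.2.unpair.1) z.unpair.2.unpair.2 with
    | none => simp [len]
    | some v =>
      have hb := evaln_bound _ _ _ v hv
      have henc : Nat.Partrec.Code.encodeCode
          (Denumerable.ofNat Nat.Partrec.Code z.unpair.2.unpair.1) = z.unpair.2.unpair.1 := by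
        have := Denumerable.encode_ofNat (α := Nat.Partrec.Code) z.unpair.2.unpair.1
        exact this
      rw [henc] at hb
      simp only [Option.getD_some, one_mul]
      unfold len at *
      rw [Nat.size_le]
      have h2 : Nat.size z.unpair.1 + 2 ≤ 2 ^ (Nat.size z + 1) := by
        have : Nat.size z < 2 ^ Nat.size z := Nat.lt_two_pow_self
        rw [pow_succ]
        rcases Nat.eq_zero_or_pos (Nat.size z) with h | h
        · rw [h]; omega
        · have : 2 ≤ 2 ^ Nat.size z := by
            calc 2 = 2 ^ 1 := rfl
              _ ≤ _ := Nat.pow_le_pow_right (by norm_num) h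
          omega
      calc v < (Nat.size z.unpair.1 + 2) ^ (Nat.size z.unpair.2.unpair.1 + 1) := hb
        _ ≤ (2 ^ (Nat.size z + 1)) ^ (Nat.size z.unpair.2.unpair.1 + 1) :=
            Nat.pow_le_pow_left h2 _
        _ = 2 ^ ((Nat.size z + 1) * (Nat.size z.unpair.2.unpair.1 + 1)) := by rw [pow_mul]
        _ ≤ _ := Nat.pow_le_pow_right (by norm_num) (by nlinarith)
  | comp _ _ h1 h2 => exact h1.comp h2
  | pairF _ _ h1 h2 => exact h1.pairF h2
  | @limRon g h b _ _ _ hg hh hb =>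
    have hg' := PBd.comp hg PBd.u1
    refine PBd.le (g := fun z => Nat.pair (g z.unpair.1) (b z)) (fun z => ?_) (hg'.pairF hb)
    cases hz : z.unpair.2 with
    | zero => unfold limRonF; exact Nat.left_le_pair _ _
    | succ y =>
      unfold limRonF
      have : Nat.pair z.unpair.1 (y + 1) = z := by rw [← hz, Nat.pair_unpair]
      rw [this]
      exact (min_le_right _ _).trans (Nat.right_le_pair _ _)


/-! ### Some polynomial-time functions. -/

theorem PTF.iteZ {c a b : ℕ → ℕ} (hc : PTF c) (ha : PTF a) (hb : PTF b) :
    PTF (fun z => if c z = 0 then a z else b z) := by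
  have := PTF.ite0.comp (hc.pairF (ha.pairF hb))
  simpa using this

/-- `2 ^ min x |y|` by limited recursion on notation. -/
theorem PTF.powMin : PTF (fun z => 2 ^ min z.unpair.1 (len z.unpair.2)) := by
  have hh : PTF (fun w => if len w.unpair.2.unpair.1 - w.unpair.1 = 0
      then 2 * w.unpair.2.unpair.2 else w.unpair.2.unpair.2) := by
    apply PTF.iteZ
    · exact PTF.comp2 PTF.sub (PTF.lenB.comp (PTF.up1.comp PTF.up2)) PTF.up1
    · exact PTF.comp2 PTF.mul (PTF.const 2) (PTF.up2.comp PTF.up2)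
    · exact PTF.up2.comp PTF.up2
  have hb : PTF (fun w => 2 ^ (len w.unpair.2 ^ 1)) := (PTF.unaryPow 1).comp PTF.up2
  have key := PTF.limRon (PTF.const 1) hh hb
  convert key using 2 with z
  generalize z.unpair.1 = x
  generalize z.unpair.2 = y
  induction y using Nat.strong_induction_on with
  | _ y ih =>
    cases y with
    | zero => unfold limRonF; simp [len]
    | succ y =>
      unfold limRonF
      rw [← ih ((y + 1) / 2) (Nat.div_lt_self (Nat.succ_pos y) one_lt_two)]
      have hl : len (y + 1) = len ((y + 1) / 2) + 1 := by
        unfold len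
        have h0 : y + 1 ≠ 0 := by omega
        have := Nat.size_bit (b := (y + 1).bodd) (n := (y + 1).div2)
          (by rw [Nat.bit_bodd_div2]; exact h0)
        rw [Nat.bit_bodd_div2, Nat.div2_val] at this
        exact this
      simp only [Nat.unpair_pair, pow_one]
      rw [hl]
      generalize len ((y + 1) / 2) = l
      split
      · have h1 : min x (l + 1) = l + 1 := by omega
        have h2 : min x l = l := by omega
        rw [h1, h2, pow_succ]; omega
      · have h1 : min x (l + 1) = min x l := by omega
        have h2 : 2 ^ min x l ≤ 2 ^ (l + 1) := Nat.pow_le_pow_right (by norm_num) (by omega)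
        rw [h1, min_eq_left h2]

/-- The power `2 ^ n` where inputs of length `n` correspond to `z`. -/
def auxP (z : ℕ) : ℕ := 2 ^ (len z / 2 - 1)

theorem PTF.auxPT : PTF auxP := by
  have h := PTF.powMin.comp (PTF.pairF (PTF.comp2 PTF.sub
    (PTF.comp2 PTF.div PTF.lenB (PTF.const 2)) (PTF.const 1)) PTF.id')
  convert h using 2 with z
  simp only [Nat.unpair_pair, auxP]
  congr 1
  omega

/-- The auxiliary pair `(x, a)` coded by `z`. -/
def auxW (z : ℕ) : ℕ := Nat.pair (z % auxP z) (z / auxP z % (2 * auxP z))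

theorem PTF.auxWT : PTF auxW := by
  unfold auxW
  exact PTF.pairF (PTF.comp2 PTF.mod PTF.id' PTF.auxPT)
    (PTF.comp2 PTF.mod (PTF.comp2 PTF.div PTF.id' PTF.auxPT)
      (PTF.comp2 PTF.mul (PTF.const 2) PTF.auxPT))

/-- The auxiliary language: next oracle answer, or final decision. -/
def auxL (O : Set ℕ) (q d : ℕ → ℕ) : Set ℕ :=
  {z | if auxP z ≤ (auxW z).unpair.2 then d (auxW z) = 1 else q (auxW z) ∈ O}

theorem auxL_NP {O : Set ℕ} (hO : O ∈ NPclass) {q d : ℕ → ℕ} (hq : PTF q) (hd : PTF d) :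
    auxL O q d ∈ NPclass := by
  obtain ⟨c, V, hV, hOV⟩ := hO
  have hQ : PTF (fun z => q (auxW z)) := hq.comp PTF.auxWT
  obtain ⟨e, he⟩ := hQ.pbd
  have hbd : ∃ E, ∀ z, len (q (auxW z)) ^ c + c ≤ len z ^ E + E := by
    have h1 : ∀ z, len (q (auxW z)) ^ c + c ≤ (len z + 2) ^ (e * c + c) := by
      intro z
      have h2 : len (q (auxW z)) ^ c ≤ (len z + 2) ^ (e * c) := by
        rw [pow_mul]; exact Nat.pow_le_pow_left (by have := he z; dsimp only at this; omega) c
      have h3 : c + 1 ≤ (len z + 2) ^ c :=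
        (Nat.lt_two_pow_self (n := c)).trans_le (Nat.pow_le_pow_left (by omega) c)
      have h4 : 1 ≤ (len z + 2) ^ (e * c) := Nat.one_le_pow _ _ (by omega)
      rw [pow_add]
      nlinarith
    generalize e * c + c = F at h1
    refine ⟨2 * F + 3 ^ F, fun z => (h1 z).trans ?_⟩
    rcases Nat.lt_or_ge (len z) 2 with h | h
    · have : (len z + 2) ^ F ≤ 3 ^ F := Nat.pow_le_pow_left (by omega) F
      omega
    · have h5 : (len z + 2) ^ F ≤ (len z ^ 2) ^ F := Nat.pow_le_pow_left (by nlinarith) F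
      rw [← pow_mul] at h5
      have h6 : len z ^ (2 * F) ≤ len z ^ (2 * F + 3 ^ F) :=
        Nat.pow_le_pow_right (by omega) (Nat.le_add_right _ _)
      exact h5.trans (h6.trans (Nat.le_add_right _ _))
  obtain ⟨E, hE⟩ := hbd
  refine ⟨E, fun w => if auxP w.unpair.1 - (auxW w.unpair.1).unpair.2 = 0 then
      d (auxW w.unpair.1) else
      (if len w.unpair.2 - (len (q (auxW w.unpair.1)) ^ c + c) = 0 then
        V (Nat.pair (q (auxW w.unpair.1)) w.unpair.2) else 0), ?_, ?_⟩
  · have hw : PTF (fun w => auxW w.unpair.1) := PTF.auxWT.comp PTF.up1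
    have hp : PTF (fun w => auxP w.unpair.1) := PTF.auxPT.comp PTF.up1
    have hqw : PTF (fun w => q (auxW w.unpair.1)) := hq.comp hw
    apply PTF.iteZ
    · exact PTF.comp2 PTF.sub hp (PTF.up2.comp hw)
    · exact hd.comp hw
    · apply PTF.iteZ
      · exact PTF.comp2 PTF.sub (PTF.lenB.comp PTF.up2)
          (PTF.comp2 PTF.add ((PTF.powc c).comp (PTF.lenB.comp hqw)) (PTF.const c))
      · exact hV.comp (hqw.pairF PTF.up2)
      · exact PTF.const 0
  · intro z
    simp only [Nat.unpair_pair, auxL, Set.mem_ofPred_eq, Nat.sub_eq_zero_iff_le]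
    by_cases h : auxP z ≤ (auxW z).unpair.2
    · simp only [h, if_true]
      exact ⟨fun h1 => ⟨0, by simp [len], h1⟩, fun ⟨_, _, h1⟩ => h1⟩
    · simp only [h, if_false]
      rw [hOV]
      constructor
      · rintro ⟨y, hy, hv⟩
        exact ⟨y, hy.trans (hE z), by rw [if_pos hy]; exact hv⟩
      · rintro ⟨y, hy, hv⟩
        by_cases h2 : len y ≤ len (q (auxW z)) ^ c + c
        · rw [if_pos h2] at hv
          exact ⟨y, h2, hv⟩
        · rw [if_neg h2] at hv
          omega

/-! ### Coding inputs of the auxiliary language. -/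

theorem testBit_one_eq (j : ℕ) : Nat.testBit 1 j = decide (j = 0) := by
  cases j with
  | zero => simp
  | succ j => simp [Nat.testBit_succ]

/-- Code of `(x, a)` as a string of length `n + r + 1`. -/
def zenc (n r x a : ℕ) : ℕ := 2 ^ n * (2 ^ r * 1 + a) + x

theorem zenc_testBit {n r x a : ℕ} (hx : x < 2 ^ n) (ha : a < 2 ^ r) (j : ℕ) :
    (zenc n r x a).testBit j = if j < n then x.testBit j else
      if j - n < r then a.testBit (j - n) else decide (j - n = r) := by
  unfold zenc
  rw [Nat.testBit_two_pow_mul_add _ hx, Nat.testBit_two_pow_mul_add _ ha]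
  split
  · rfl
  · split
    · rfl
    · rw [testBit_one_eq]
      congr 1
      apply propext
      omega

theorem zenc_len {n r x a : ℕ} (hx : x < 2 ^ n) (ha : a < 2 ^ r) : len (zenc n r x a) = n + r + 1 := by
  unfold len
  have hm : 2 ^ n * (a + 1) ≤ 2 ^ n * 2 ^ r := Nat.mul_le_mul_left _ ha
  apply le_antisymm
  · rw [Nat.size_le, pow_succ, pow_add]
    unfold zenc
    nlinarith
  · have : n + r < Nat.size (zenc n r x a) := by
      rw [Nat.lt_size, pow_add]
      unfold zenc
      nlinarith [Nat.zero_le (2 ^ n * a)]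
    omega

theorem zenc_aux {n r x a : ℕ} (hx : x < 2 ^ n) (ha : a < 2 ^ (n + 1)) (h1 : n + 1 ≤ r)
    (h2 : r ≤ n + 2) : auxP (zenc n r x a) = 2 ^ n ∧ auxW (zenc n r x a) = Nat.pair x a := by
  have ha' : a < 2 ^ r := ha.trans_le (Nat.pow_le_pow_right (by norm_num) h1)
  have hp : auxP (zenc n r x a) = 2 ^ n := by
    unfold auxP
    rw [zenc_len hx ha']
    congr 1
    omega
  refine ⟨hp, ?_⟩
  unfold auxW
  rw [hp]
  have hpos : 0 < 2 ^ n := by positivity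
  have e1 : zenc n r x a % 2 ^ n = x := by
    unfold zenc
    rw [Nat.mul_add_mod, Nat.mod_eq_of_lt hx]
  have e2 : zenc n r x a / 2 ^ n = 2 ^ r * 1 + a := by
    unfold zenc
    rw [Nat.mul_add_div hpos, Nat.div_eq_of_lt hx, add_zero]
  rw [e1, e2]
  congr 1
  obtain ⟨s, rfl⟩ := Nat.exists_eq_add_of_le h1
  rw [mul_one, pow_add, ← pow_succ', Nat.mul_add_mod, Nat.mod_eq_of_lt ha]

theorem encodeBools_snoc (l : List Bool) (b : Bool) :
    encodeBools (l ++ [b]) = 2 * encodeBools l + cond b 1 0 := by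
  simp [encodeBools]

theorem encodeBools_bounds (l : List Bool) :
    2 ^ l.length ≤ encodeBools l ∧ encodeBools l < 2 ^ (l.length + 1) := by
  induction l using List.reverseRecOn with
  | nil => simp [encodeBools]
  | append_singleton l b ih =>
    rw [encodeBools_snoc]
    simp only [List.length_append, List.length_singleton]
    rw [pow_succ, pow_succ 2 (l.length + 1)]
    cases b <;> simp only [cond_true, cond_false] <;> omega

theorem encodeBools_testBit (l : List Bool) (j : ℕ) :
    (encodeBools l).testBit j =
      if j < l.length then l.getD (l.length - 1 - j) false else decide (j = l.length) := by
  induction l using List.reverseRecOn generalizing j with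
  | nil => simp [encodeBools, testBit_one_eq]
  | append_singleton l b ih =>
    rw [encodeBools_snoc]
    cases j with
    | zero =>
      rw [Nat.testBit_zero]
      cases b <;> simp [List.getD] <;> omega
    | succ j =>
      rw [Nat.testBit_succ]
      have : (2 * encodeBools l + cond b 1 0) / 2 = encodeBools l := by
        cases b <;> simp only [cond_true, cond_false] <;> omega
      rw [this, ih]
      simp only [List.length_append, List.length_singleton, Nat.add_lt_add_iff_right,
        Nat.add_right_cancel_iff]
      split
      · rename_i h
        rw [List.getD_append _ _ _ _ (by omega)]
        congr 1
        omega
      · rfl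

theorem answers_length (O : Set ℕ) (q : ℕ → ℕ) (x i : ℕ) : (answers O q x i).length = i := by
  induction i with
  | zero => simp [answers]
  | succ i ih => simp [answers, ih]

theorem answers_getD (O : Set ℕ) (q : ℕ → ℕ) (x i j : ℕ) (h : j < i) :
    (answers O q x i).getD j false = true ↔
      q (Nat.pair x (encodeBools (answers O q x j))) ∈ O := by
  induction i with
  | zero => omega
  | succ i ih =>
    have hl := answers_length O q x i
    rcases Nat.lt_succ_iff_lt_or_eq.1 h with h' | rfl
    · rw [← ih h']
      simp only [answers]
      rw [List.getD_append _ _ _ _ (by omega)]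
    · simp only [answers]
      rw [List.getD_append_right _ _ _ _ (by omega), hl]
      simp


/-! ### Composition of circuits. -/

theorem circEvalList_snoc (C : List ℕ) (g : ℕ) (x : ℕ → Bool) :
    circEvalList (C ++ [g]) x = circEvalList C x ++ [gateEval x (circEvalList C x) g] := by
  simp [circEvalList]

theorem circEvalList_length (C : List ℕ) (x : ℕ → Bool) :
    (circEvalList C x).length = C.length := by
  induction C using List.reverseRecOn with
  | nil => simp [circEvalList]
  | append_singleton C g ih => rw [circEvalList_snoc]; simp [ih]

theorem gateEval_pair4 (x : ℕ → Bool) (p : List Bool) (a b : ℕ) :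
    gateEval x p (Nat.pair 4 (Nat.pair a b)) = (p.getD a false || p.getD b false) := by
  simp [gateEval]

theorem gateEval_pair3 (x : ℕ → Bool) (p : List Bool) (a b : ℕ) :
    gateEval x p (Nat.pair 3 (Nat.pair a b)) = (p.getD a false && p.getD b false) := by
  simp [gateEval]

theorem gateEval_pair2 (x : ℕ → Bool) (p : List Bool) (a : ℕ) :
    gateEval x p (Nat.pair 2 a) = !(p.getD a false) := by
  simp [gateEval]

theorem gateEval_pair0 (x : ℕ → Bool) (p : List Bool) (a : ℕ) :
    gateEval x p (Nat.pair 0 a) = (a % 2 == 1) := by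
  simp [gateEval]

theorem gateEval_pair1 (x : ℕ → Bool) (p : List Bool) (a : ℕ) :
    gateEval x p (Nat.pair 1 a) = x (a % (p.length + 1)) := by
  simp [gateEval]

/-- Copying the circuit `C` on top of `D`, with inputs taken from wires of `D`. -/
theorem circ_copy (D C : List ℕ) (F : ℕ) (σ : ℕ → ℕ) (hF : F < D.length)
    (hσ : ∀ j, σ j < D.length) :
    ∃ D' : List ℕ, D'.length = C.length ∧ ∀ x y : ℕ → Bool,
      (circEvalList D x).getD F false = false →
      (∀ j, y j = (circEvalList D x).getD (σ j) false) →
      circEvalList (D ++ D') x = circEvalList D x ++ circEvalList C y := by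
  induction C using List.reverseRecOn with
  | nil => exact ⟨[], rfl, fun x y _ _ => by simp [circEvalList]⟩
  | append_singleton C g ih =>
    obtain ⟨D', hlen, hD'⟩ := ih
    set w : ℕ → ℕ := fun a => if a < C.length then D.length + a else F with hw
    have hwire : ∀ x y : ℕ → Bool, (circEvalList D x).getD F false = false → ∀ a,
        (circEvalList D x ++ circEvalList C y).getD (w a) false =
          (circEvalList C y).getD a false := by
      intro x y hf a
      have hlD := circEvalList_length D x
      have hlC := circEvalList_length C y
      simp only [hw]
      split
      · rw [List.getD_append_right _ _ _ _ (by omega)]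
        congr 1
        omega
      · rw [List.getD_append _ _ _ _ (by omega), hf, List.getD_eq_default _ _ (by omega)]
    have hgate : ∃ g', ∀ x y : ℕ → Bool, (circEvalList D x).getD F false = false →
        (∀ j, y j = (circEvalList D x).getD (σ j) false) →
        gateEval x (circEvalList D x ++ circEvalList C y) g' =
          gateEval y (circEvalList C y) g := by
      have h5 : g.unpair.1 % 5 < 5 := Nat.mod_lt _ (by norm_num)
      have hcases : g.unpair.1 % 5 = 0 ∨ g.unpair.1 % 5 = 1 ∨ g.unpair.1 % 5 = 2 ∨
        g.unpair.1 % 5 = 3 ∨ g.unpair.1 % 5 = 4 := by omega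
      rcases hcases with h | h | h | h | h
      · refine ⟨Nat.pair 0 g.unpair.2, fun x y hf hy => ?_⟩
        rw [gateEval_pair0]
        simp [gateEval, h]
      · set j := g.unpair.2 % (C.length + 1) with hj
        refine ⟨Nat.pair 4 (Nat.pair (σ j) (σ j)), fun x y hf hy => ?_⟩
        rw [gateEval_pair4, List.getD_append _ _ _ _ (by rw [circEvalList_length]; exact hσ j),
          ← hy j, Bool.or_self]
        simp [gateEval, h, circEvalList_length, hj]
      · refine ⟨Nat.pair 2 (w g.unpair.2), fun x y hf hy => ?_⟩
        rw [gateEval_pair2, hwire x y hf]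
        simp [gateEval, h]
      · refine ⟨Nat.pair 3 (Nat.pair (w g.unpair.2.unpair.1) (w g.unpair.2.unpair.2)),
          fun x y hf hy => ?_⟩
        rw [gateEval_pair3, hwire x y hf, hwire x y hf]
        simp [gateEval, h]
      · refine ⟨Nat.pair 4 (Nat.pair (w g.unpair.2.unpair.1) (w g.unpair.2.unpair.2)),
          fun x y hf hy => ?_⟩
        rw [gateEval_pair4, hwire x y hf, hwire x y hf]
        simp [gateEval, h]
    obtain ⟨g', hg'⟩ := hgate
    refine ⟨D' ++ [g'], by simp [hlen], fun x y hf hy => ?_⟩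
    rw [← List.append_assoc, circEvalList_snoc, circEvalList_snoc, hD' x y hf hy,
      hg' x y hf hy, List.append_assoc]

/-- The circuit providing the input bits, and the constants. -/
theorem circ_base (n : ℕ) : ∃ D : List ℕ, D.length = n + 2 ∧ ∀ x : ℕ → Bool,
    (∀ j < n, (circEvalList D x).getD j false = x j) ∧
    (circEvalList D x).getD n false = false ∧ (circEvalList D x).getD (n + 1) false = true := by
  have h : ∃ D : List ℕ, D.length = n ∧ ∀ x : ℕ → Bool,
      ∀ j < n, (circEvalList D x).getD j false = x j := by
    induction n with
    | zero => exact ⟨[], rfl, fun x j hj => by omega⟩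
    | succ n ih =>
      obtain ⟨D, hD, h⟩ := ih
      refine ⟨D ++ [Nat.pair 1 n], by simp [hD], fun x j hj => ?_⟩
      have hl := circEvalList_length D x
      rw [circEvalList_snoc, gateEval_pair1]
      rcases Nat.lt_succ_iff_lt_or_eq.1 hj with h' | rfl
      · rw [List.getD_append _ _ _ _ (by omega), h x j h']
      · rw [List.getD_append_right _ _ _ _ (by omega), hl, hD]
        simp
  obtain ⟨D, hD, h⟩ := h
  refine ⟨D ++ [Nat.pair 0 0] ++ [Nat.pair 0 1], by simp [hD], fun x => ?_⟩
  have hl := circEvalList_length D x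
  rw [circEvalList_snoc, circEvalList_snoc, gateEval_pair0, gateEval_pair0]
  refine ⟨fun j hj => ?_, ?_, ?_⟩
  · rw [List.append_assoc, List.getD_append _ _ _ _ (by omega), h x j hj]
  · rw [List.append_assoc, List.getD_append_right _ _ _ _ (by omega), hl, hD]
    simp
  · rw [List.append_assoc, List.getD_append_right _ _ _ _ (by omega), hl, hD]
    simp

theorem circEval_eq_getD (C : List ℕ) (x : ℕ → Bool) :
    circEval C x = (circEvalList C x).getD (C.length - 1) false := by
  unfold circEval
  have hl := circEvalList_length C x
  rw [← hl, List.getD_eq_getElem?_getD, ← List.getLast?_eq_getElem?, List.getLastD_eq_getLast?]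

/-- The main simulation: iterating a circuit for the auxiliary language. -/
theorem circ_iter (O : Set ℕ) (q d : ℕ → ℕ) (n r : ℕ) (hr1 : n + 1 ≤ r) (hr2 : r ≤ n + 2)
    (C : List ℕ) (hC : 1 ≤ C.length)
    (hCL : ∀ z, len z = n + r + 1 → (circEval C z.testBit = true ↔ z ∈ auxL O q d)) :
    ∀ i, i ≤ n + 1 → ∃ D : List ℕ, D.length = n + 2 + i * C.length ∧ ∀ x : ℕ, len x = n →
      (∀ j < n, (circEvalList D x.testBit).getD j false = x.testBit j) ∧
      (circEvalList D x.testBit).getD n false = false ∧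
      (circEvalList D x.testBit).getD (n + 1) false = true ∧
      ∀ j < i, (circEvalList D x.testBit).getD (n + 2 + j * C.length + (C.length - 1)) false =
        circEval C (zenc n r x (encodeBools (answers O q x j))).testBit := by
  intro i
  induction i with
  | zero =>
    intro _
    obtain ⟨D, hD, h⟩ := circ_base n
    refine ⟨D, by omega, fun x _ => ⟨(h _).1, (h _).2.1, (h _).2.2, fun j hj => by omega⟩⟩
  | succ i ih =>
    intro hi
    obtain ⟨D, hD, h⟩ := ih (by omega)
    have hwlt : ∀ j < i, n + 2 + j * C.length + (C.length - 1) < D.length := by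
      intro j hj
      have : (j + 1) * C.length ≤ i * C.length := Nat.mul_le_mul_right _ hj
      rw [add_mul] at this
      omega
    set σ : ℕ → ℕ := fun j => if j < n then j else
      if j - n < i then n + 2 + (i - 1 - (j - n)) * C.length + (C.length - 1) else
      if j - n = i then n + 1 else if j - n = r then n + 1 else n with hσdef
    have hσ : ∀ j, σ j < D.length := by
      intro j
      simp only [hσdef]
      split_ifs
      · omega
      · exact hwlt _ (by omega)
      · omega
      · omega
      · omega
    obtain ⟨D', hD', hcopy⟩ := circ_copy D C n σ (by omega) hσ
    refine ⟨D ++ D', by rw [List.length_append, hD, hD']; ring, fun x hx => ?_⟩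
    obtain ⟨hin, hf, ht, hans⟩ := h x hx
    have hxlt : x < 2 ^ n := by rw [← hx]; exact Nat.lt_size_self x
    have hlen_a : ∀ j, (answers O q x j).length = j := answers_length O q x
    have halt : ∀ j ≤ n, encodeBools (answers O q x j) < 2 ^ (n + 1) := by
      intro j hj
      have := (encodeBools_bounds (answers O q x j)).2
      rw [hlen_a] at this
      exact this.trans_le (Nat.pow_le_pow_right (by norm_num) (by omega))
    have hr : 2 ^ (n + 1) ≤ 2 ^ r := Nat.pow_le_pow_right (by norm_num) hr1
    have hansbit : ∀ j < i, circEval C (zenc n r x (encodeBools (answers O q x j))).testBit =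
        (answers O q x i).getD j false := by
      intro j hj
      have ha := halt j (by omega)
      rw [Bool.eq_iff_iff, hCL _ (zenc_len hxlt (ha.trans_le hr)), answers_getD O q x i j hj]
      obtain ⟨e1, e2⟩ := zenc_aux hxlt ha hr1 hr2
      simp only [auxL, Set.mem_ofPred_eq, e1, e2, Nat.unpair_pair]
      rw [if_neg]
      have := (encodeBools_bounds (answers O q x j)).2
      rw [hlen_a] at this
      have h3 : 2 ^ (j + 1) ≤ 2 ^ n := Nat.pow_le_pow_right (by norm_num) (by omega)
      omega
    have hE := hcopy x.testBit (zenc n r x (encodeBools (answers O q x i))).testBit hf (by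
      intro j
      have ha := halt i (by omega)
      rw [zenc_testBit hxlt (ha.trans_le hr), encodeBools_testBit, hlen_a]
      simp only [hσdef]
      by_cases h1 : j < n
      · simp only [h1, if_true]; exact (hin j h1).symm
      · simp only [h1, if_false]
        by_cases h2 : j - n < i
        · have h3 : j - n < r := by omega
          simp only [h2, h3, if_true]
          rw [hans _ (by omega), hansbit _ (by omega)]
        · simp only [h2, if_false]
          by_cases h4 : j - n = i
          · have h3 : i < r := by omega
            simp only [h4, if_true, h3, ht, decide_true]
          · simp only [h4, if_false, decide_false]
            by_cases h5 : j - n = r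
            · simp only [h5, if_true, ht, lt_irrefl, if_false, decide_true]
            · simp only [h5, if_false, hf, decide_false, ite_self])
    have hlD := circEvalList_length D x.testBit
    rw [hE]
    refine ⟨fun j hj => ?_, ?_, ?_, fun j hj => ?_⟩
    · rw [List.getD_append _ _ _ _ (by omega)]; exact hin j hj
    · rw [List.getD_append _ _ _ _ (by omega)]; exact hf
    · rw [List.getD_append _ _ _ _ (by omega)]; exact ht
    · rcases Nat.lt_succ_iff_lt_or_eq.1 hj with h' | rfl
      · rw [List.getD_append _ _ _ _ (by rw [hlD]; exact hwlt j h')]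
        exact hans j h'
      · rw [List.getD_append_right _ _ _ _ (by omega), circEval_eq_getD]
        congr 1
        omega

theorem size_arith (k n : ℕ) (hn : 2 * 5 ^ k + 4 ≤ n) (m : ℕ) (hm : m ≤ 2 * n + 3) :
    n + 2 + (n + 1) * m ^ k ≤ n ^ (k + 2) := by
  have h1 : m ^ k ≤ 5 ^ k * n ^ k := by
    rw [← mul_pow]; exact Nat.pow_le_pow_left (by omega) k
  have h2 : 1 ≤ n ^ k := Nat.one_le_pow _ _ (by omega)
  calc n + 2 + (n + 1) * m ^ k ≤ (n + 2) * n ^ k + (2 * n) * (5 ^ k * n ^ k) := by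
        apply Nat.add_le_add
        · nlinarith
        · exact Nat.mul_le_mul (by omega) h1
    _ = ((n + 2) + 2 * n * 5 ^ k) * n ^ k := by ring
    _ ≤ (n * n) * n ^ k := by
        apply Nat.mul_le_mul_right
        have h3 := Nat.mul_le_mul_left n hn
        have h4 : n * (2 * 5 ^ k + 4) = 2 * n * 5 ^ k + 4 * n := by ring
        omega
    _ = n ^ (k + 2) := by ring

theorem circ_main {O L : Set ℕ} {q d : ℕ → ℕ}
    (hL : ∀ x, x ∈ L ↔ d (Nat.pair x (encodeBools (answers O q x (len x)))) = 1)
    (k n : ℕ) (hn : 2 * 5 ^ k + 4 ≤ n) (m : ℕ) (hm1 : 2 * n + 2 ≤ m) (hm2 : m ≤ 2 * n + 3)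
    (h : HasCircAt (auxL O q d) m (m ^ k)) : HasCircAt L n (n ^ (k + 2)) := by
  have h' : ∃ C : List ℕ, 1 ≤ C.length ∧ C.length ≤ m ^ k ∧
      ∀ x : ℕ, len x = m → (circEval C x.testBit = true ↔ x ∈ auxL O q d) := by
    obtain ⟨C, hC, hx⟩ := h
    cases C with
    | nil =>
      refine ⟨[Nat.pair 0 0], by simp, by simpa using Nat.one_le_pow _ _ (by omega), ?_⟩
      intro x hlx
      rw [← hx x hlx]
      simp [circEval, circEvalList, gateEval]
    | cons g C => exact ⟨g :: C, by simp, hC, hx⟩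
  obtain ⟨C, hC1, hCm, hC⟩ := h'
  obtain ⟨r, rfl⟩ : ∃ r, m = n + r + 1 := ⟨m - 1 - n, by omega⟩
  obtain ⟨D, hD, hx⟩ := circ_iter O q d n r (by omega) (by omega) C hC1 hC (n + 1) le_rfl
  refine ⟨D, ?_, fun x hlx => ?_⟩
  · rw [hD]
    exact (Nat.add_le_add_left (Nat.mul_le_mul_left _ hCm) _).trans (size_arith k n hn _ hm2)
  · have hw := (hx x hlx).2.2.2 n (by omega)
    have hidx : D.length - 1 = n + 2 + n * C.length + (C.length - 1) := by
      rw [hD, add_mul]; omega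
    have hxlt : x < 2 ^ n := by rw [← hlx]; exact Nat.lt_size_self x
    have hb := encodeBools_bounds (answers O q x n)
    rw [answers_length] at hb
    have hr : 2 ^ (n + 1) ≤ 2 ^ r := Nat.pow_le_pow_right (by norm_num) (by omega)
    obtain ⟨e1, e2⟩ := zenc_aux hxlt hb.2 (r := r) (by omega) (by omega)
    rw [circEval_eq_getD, hidx, hw, hC _ (zenc_len hxlt (hb.2.trans_le hr)), hL, hlx]
    simp only [auxL, Set.mem_ofPred_eq, e1, e2, Nat.unpair_pair]
    rw [if_pos hb.1]

theorem main_aux (k : ℕ) (H : NPclass ⊆ ioSIZE (fun n => n ^ k)) :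
    ∀ L ∈ PNPnClass, ∃ Laux ∈ NPclass, ∃ (g : ℕ → ℕ) (n₀ : ℕ),
      {n | HasCircAt Laux (g n) (g n ^ k)}.Infinite ∧
      ∀ n ≥ n₀, HasCircAt Laux (g n) (g n ^ k) → HasCircAt L n (n ^ (k + 2)) := by
  classical
  rintro L ⟨O, hO, q, d, hq, hd, hL⟩
  have hNP := auxL_NP hO.1 hq hd
  refine ⟨auxL O q d, hNP, fun n => if HasCircAt (auxL O q d) (2 * n + 2) ((2 * n + 2) ^ k)
    then 2 * n + 2 else 2 * n + 3, 2 * 5 ^ k + 4, ?_, ?_⟩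
  · rw [Set.infinite_iff_exists_gt]
    intro N
    obtain ⟨m, hm, hc⟩ := H hNP (2 * N + 4)
    refine ⟨m / 2 - 1, ?_, by omega⟩
    simp only [Set.mem_ofPred_eq]
    split_ifs with hif
    · exact hif
    · have hm' : m = 2 * (m / 2 - 1) + 2 ∨ m = 2 * (m / 2 - 1) + 3 := by omega
      rcases hm' with h | h
      · rw [← h] at hif; exact absurd hc hif
      · rw [← h]; exact hc
  · intro n hn h
    refine circ_main hL k n hn _ ?_ ?_ h <;> dsimp only <;> split_ifs <;> omega

/-- **Lemma 2.1.**  If `NP ⊆ i.o.SIZE[n^k]` then `P^{NP[n]} ⊆ i.o.SIZE[n^{k+2}]`.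
Moreover, for every `L ∈ P^{NP[n]}` the size-`n^{k+2}` circuits can be taken to exist
on the same (infinitely many) input lengths on which the assumed circuits for a
suitable auxiliary `NP` language `Laux` exist (input length `g n` for `Laux`
corresponding to input length `n` for `L`). -/
theorem PNPn_in_ioSize_of_NP_in_ioSize (k : ℕ)
    (H : NPclass ⊆ ioSIZE (fun n => n ^ k)) :
    PNPnClass ⊆ ioSIZE (fun n => n ^ (k + 2)) ∧
    ∀ L ∈ PNPnClass, ∃ Laux ∈ NPclass, ∃ (g : ℕ → ℕ) (n₀ : ℕ),
      {n | HasCircAt Laux (g n) (g n ^ k)}.Infinite ∧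
      ∀ n ≥ n₀, HasCircAt Laux (g n) (g n ^ k) → HasCircAt L n (n ^ (k + 2)) := by
  have hmain := main_aux k H
  refine ⟨fun L hL => ?_, hmain⟩
  obtain ⟨Laux, _, g, n₀, hinf, himp⟩ := hmain L hL
  intro N
  obtain ⟨n, hn, hlt⟩ := hinf.exists_gt (max N n₀)
  have h1 := le_max_left N n₀
  have h2 := le_max_right N n₀
  exact ⟨n, by omega, himp n (by omega) hn⟩


end CLB
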